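/- Define, for g > 0 and x̃ ∈ ℂ, m_g(x̃) = (1−λ)·φ_{τ²}(x̃) + λ·∫_ℂ φ_{g²}(x)·φ_{τ²}(x̃−x) dx, B_g(x̃) = λ·∫_ℂ x·φ_{g²}(x)·φ_{τ²}(x̃−x) dx, and A_g(x̃) = λ·∫_ℂ |x|²·φ_{g²}(x)·φ_{τ²}(x̃−x) dx. Then the large-scale-fading-averaged Bayes risk (MSE of the MMSE denoiser with known large-scale fading) satisfies ∫₀^∞ p_G(g)·(∫_ℂ (A_g(x̃) − |B_g(x̃)|²/m_g(x̃)) dx̃) dg = ∫₀^∞ a·Q(g)·g^{−γ}·(λ·g²·τ²/(g²+τ²)) dg + ∫₀^∞ a·λ·Q(g)·g^{4−γ}·(1 − φ̄₁(g²/τ²))/(g²+τ²) dg. -/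

import Mathlib

open MeasureTheory Set
open scoped ENNReal

noncomputable section

/-- `Q(g) = ∫_{b ln g + c}^∞ exp(-s²) ds`. -/
def Qfun (b c g : ℝ) : ℝ := ∫ s in Set.Ioi (b * Real.log g + c), Real.exp (-s ^ 2)

/-- Circularly symmetric complex Gaussian density of variance `v` on `ℂ ≅ ℝ²`. -/
def cgauss (v : ℝ) (x : ℂ) : ℝ := (Real.pi * v)⁻¹ * Real.exp (-‖x‖ ^ 2 / v)

/-- Channel density `p_H(h) = (a/π)∫₀^∞ g^{-γ-2} Q(g) exp(-|h|²/g²) dg`. -/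
def pH (a γ b c : ℝ) (h : ℂ) : ℝ :=
  (a / Real.pi) * ∫ g in Set.Ioi (0 : ℝ), g ^ (-γ - 2) * Qfun b c g * Real.exp (-‖h‖ ^ 2 / g ^ 2)

/-- `ν_i(s) = ∫₀^∞ g^{2-γ} Q(g) (g²+τ²)^{-(i+1)} exp(-s/(g²+τ²)) dg`. -/
def nufun (γ b c τ : ℝ) (i : ℕ) (s : ℝ) : ℝ :=
  ∫ g in Set.Ioi (0 : ℝ),
    g ^ (2 - γ) * Qfun b c g / (g ^ 2 + τ ^ 2) ^ (i + 1) * Real.exp (-s / (g ^ 2 + τ ^ 2))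

/-- `ξ_i(s) = ((1-λ)/(λ a τ^{2i})) exp(-s/τ²) + ∫₀^∞ g^{-γ} Q(g) (g²+τ²)^{-i} exp(-s/(g²+τ²)) dg`. -/
def xifun (a γ b c τ lam : ℝ) (i : ℕ) (s : ℝ) : ℝ :=
  (1 - lam) / (lam * a * τ ^ (2 * i)) * Real.exp (-s / τ ^ 2) +
    ∫ g in Set.Ioi (0 : ℝ),
      g ^ (-γ) * Qfun b c g / (g ^ 2 + τ ^ 2) ^ i * Real.exp (-s / (g ^ 2 + τ ^ 2))

/-- The large-scale fading density `p_G(g) = a g^{-γ} Q(g)` (for `g > 0`, else `0`). -/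
def pG (a γ b c g : ℝ) : ℝ := if 0 < g then a * g ^ (-γ) * Qfun b c g else 0

/-- `φ̄_i(s) = ∫₀^∞ tⁱ e^{-t} / (1 + ((1-λ)/λ)(1+s)ⁱ e^{-st}) dt`. -/
def phibar (lam : ℝ) (i : ℕ) (s : ℝ) : ℝ :=
  ∫ t in Set.Ioi (0 : ℝ),
    t ^ i * Real.exp (-t) / (1 + (1 - lam) / lam * (1 + s) ^ i * Real.exp (-s * t))


lemma integrable_comp_norm_sq_iff (f : ℝ → ℝ) :
    Integrable (fun x : ℂ => f (‖x‖ ^ 2)) ↔ IntegrableOn f (Ioi 0) := by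
  rw [integrable_fun_norm_addHaar (μ := volume) (f := fun y => f (y ^ 2)),
    ← integrableOn_Ioi_comp_rpow_iff f (two_ne_zero)]
  have h : ∀ x : ℝ, x ^ (Module.finrank ℝ ℂ - 1) • f (x ^ 2) = x * f (x ^ 2) := by simp
  simp_rw [h]
  have h2 : ∀ x : ℝ, (|(2:ℝ)| * x ^ ((2:ℝ) - 1)) • f (x ^ (2:ℝ)) = 2 * (x * f (x ^ 2)) := by
    intro x
    norm_num
    ring
  simp_rw [h2]
  exact (integrable_const_mul_iff (by norm_num) _).symm

lemma integral_comp_norm_sq (f : ℝ → ℝ) :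
    ∫ x : ℂ, f (‖x‖ ^ 2) = Real.pi * ∫ t in Ioi (0 : ℝ), f t := by
  rw [integral_fun_norm_addHaar (volume : Measure ℂ) (fun y => f (y ^ 2)),
    ← integral_comp_rpow_Ioi_of_pos (g := f) (two_pos)]
  have h2 : ∀ x : ℝ, ((2 : ℝ) * x ^ ((2:ℝ) - 1)) • f (x ^ (2:ℝ)) = 2 * (x * f (x ^ 2)) := by
    intro x
    norm_num
    ring
  simp_rw [h2]
  rw [integral_const_mul]
  simp [Measure.real]
  ring

lemma integrable_cgauss_mul_comp_iff {v : ℝ} (hv : 0 < v) (F : ℝ → ℝ) :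
    Integrable (fun x : ℂ => cgauss v x * F (‖x‖ ^ 2 / v)) ↔
      IntegrableOn (fun t => Real.exp (-t) * F t) (Ioi 0) := by
  have h := integrable_comp_norm_sq_iff
    (fun t => (Real.pi * v)⁻¹ * (Real.exp (-(v⁻¹ * t)) * F (v⁻¹ * t)))
  have h' : (fun x : ℂ => cgauss v x * F (‖x‖ ^ 2 / v)) = fun x : ℂ =>
      (Real.pi * v)⁻¹ * (Real.exp (-(v⁻¹ * ‖x‖ ^ 2)) * F (v⁻¹ * ‖x‖ ^ 2)) := by
    ext x
    simp only [cgauss, div_eq_inv_mul, mul_assoc, mul_neg]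
  rw [h', h, IntegrableOn, integrable_const_mul_iff (by simp [Real.pi_ne_zero, hv.ne']), ← IntegrableOn,
    integrableOn_Ioi_comp_mul_left_iff (fun t => Real.exp (-t) * F t) 0 (inv_pos.2 hv), mul_zero]

lemma integral_cgauss_mul_comp {v : ℝ} (hv : 0 < v) (F : ℝ → ℝ) :
    ∫ x : ℂ, cgauss v x * F (‖x‖ ^ 2 / v) = ∫ t in Ioi (0 : ℝ), Real.exp (-t) * F t := by
  have h := integral_comp_norm_sq
    (fun t => (Real.pi * v)⁻¹ * (Real.exp (-(v⁻¹ * t)) * F (v⁻¹ * t)))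
  have h' : (fun x : ℂ => cgauss v x * F (‖x‖ ^ 2 / v)) = fun x : ℂ =>
      (Real.pi * v)⁻¹ * (Real.exp (-(v⁻¹ * ‖x‖ ^ 2)) * F (v⁻¹ * ‖x‖ ^ 2)) := by
    ext x
    simp only [cgauss, div_eq_inv_mul, mul_assoc, mul_neg]
  rw [h', h, integral_const_mul,
    integral_comp_mul_left_Ioi (fun t => Real.exp (-t) * F t) 0 (inv_pos.2 hv), mul_zero]
  have := Real.pi_pos.ne'
  simp
  field_simp

lemma integrableOn_exp_neg_mul_id : IntegrableOn (fun t => Real.exp (-t) * t) (Ioi 0) := by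
  have := Real.GammaIntegral_convergent (s := 2) two_pos
  norm_num at this
  exact this

lemma integral_exp_neg_mul_id : ∫ t in Ioi (0 : ℝ), Real.exp (-t) * t = 1 := by
  have := Real.Gamma_eq_integral (s := 2) two_pos
  norm_num at this
  exact this.symm

lemma integrableOn_exp_neg : IntegrableOn (fun t => Real.exp (-t)) (Ioi 0) :=
  integrableOn_exp_neg_Ioi 0

lemma integrable_cgauss {v : ℝ} (hv : 0 < v) : Integrable (cgauss v) := by
  have := (integrable_cgauss_mul_comp_iff hv (fun _ => 1)).2 (by simpa using integrableOn_exp_neg)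
  simpa using this

lemma integral_cgauss {v : ℝ} (hv : 0 < v) : ∫ x, cgauss v x = 1 := by
  have := integral_cgauss_mul_comp hv (fun _ => 1)
  simpa only [mul_one, integral_exp_neg_Ioi_zero] using this

lemma integrable_cgauss_mul_norm_sq {v : ℝ} (hv : 0 < v) :
    Integrable (fun x : ℂ => cgauss v x * ‖x‖ ^ 2) := by
  have := ((integrable_cgauss_mul_comp_iff hv (fun t => t)).2 integrableOn_exp_neg_mul_id).const_mul v
  refine this.congr (Filter.Eventually.of_forall fun x => ?_)
  simp only
  field_simp

lemma integral_cgauss_mul_norm_sq {v : ℝ} (hv : 0 < v) :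
    ∫ x : ℂ, cgauss v x * ‖x‖ ^ 2 = v := by
  have := integral_cgauss_mul_comp hv (fun t => v * t)
  simp only [mul_div_cancel₀ _ hv.ne'] at this
  rw [this]
  simp only [mul_left_comm _ v]
  rw [integral_const_mul, integral_exp_neg_mul_id, mul_one]

lemma continuous_cgauss (v : ℝ) : Continuous (cgauss v) := by
  unfold cgauss; fun_prop

lemma cgauss_nonneg {v : ℝ} (hv : 0 < v) (x : ℂ) : 0 ≤ cgauss v x := by
  have := Real.pi_pos
  unfold cgauss; positivity

lemma integrable_id_mul_cgauss {v : ℝ} (hv : 0 < v) :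
    Integrable (fun x : ℂ => x * (cgauss v x : ℂ)) := by
  refine ((integrable_cgauss hv).add (integrable_cgauss_mul_norm_sq hv)).mono'
    (continuous_id.mul (Complex.continuous_ofReal.comp (continuous_cgauss v))).aestronglyMeasurable
    (Filter.Eventually.of_forall fun x => ?_)
  have := cgauss_nonneg hv x
  simp only [norm_mul, Complex.norm_real, Real.norm_eq_abs, abs_of_nonneg this, Pi.add_apply]
  nlinarith [sq_nonneg (‖x‖ - 1), sq_nonneg ‖x‖]

lemma integral_id_mul_cgauss (v : ℝ) : ∫ x : ℂ, x * (cgauss v x : ℂ) = 0 := by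
  have h := integral_neg_eq_self (fun x : ℂ => x * (cgauss v x : ℂ)) volume
  have h2 : ∀ x : ℂ, -x * (cgauss v (-x) : ℂ) = -(x * (cgauss v x : ℂ)) := by
    intro x; simp [cgauss]
  simp only [h2, integral_neg] at h
  exact self_eq_neg.1 h.symm

lemma cgauss_mul_cgauss {v T : ℝ} (hv : 0 < v) (hT : 0 < T) (x y : ℂ) :
    cgauss v x * cgauss T (y - x) =
      cgauss (v + T) y * cgauss (v * T / (v + T)) (x - (v / (v + T) : ℝ) * y) := by
  have := Real.pi_pos.ne'
  have hS : 0 < v + T := by positivity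
  unfold cgauss
  rw [mul_mul_mul_comm, mul_mul_mul_comm (Real.pi * (v + T))⁻¹, ← Real.exp_add, ← Real.exp_add]
  congr 1
  · field_simp
  · congr 1
    simp only [← Complex.normSq_eq_norm_sq, Complex.normSq_apply, Complex.sub_re, Complex.sub_im,
      Complex.mul_re, Complex.mul_im, Complex.ofReal_re, Complex.ofReal_im]
    field_simp
    ring

lemma integral_cgauss_conv {v T : ℝ} (hv : 0 < v) (hT : 0 < T) (y : ℂ) :
    ∫ x, cgauss v x * cgauss T (y - x) = cgauss (v + T) y := by
  simp_rw [cgauss_mul_cgauss hv hT]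
  rw [integral_const_mul, integral_sub_right_eq_self, integral_cgauss (by positivity), mul_one]

lemma integral_id_mul_cgauss_conv {v T : ℝ} (hv : 0 < v) (hT : 0 < T) (y : ℂ) :
    ∫ x : ℂ, x * ((cgauss v x * cgauss T (y - x) : ℝ) : ℂ) =
      ((v / (v + T) * cgauss (v + T) y : ℝ) : ℂ) * y := by
  simp_rw [cgauss_mul_cgauss hv hT]
  set k : ℂ := ((v / (v + T) : ℝ) : ℂ) with hk
  set w := v * T / (v + T)
  have hw : 0 < w := by positivity
  rw [← integral_add_right_eq_self _ (k * y)]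
  have h : ∀ x : ℂ, (x + k * y) * ((cgauss (v + T) y * cgauss w (x + k * y - k * y) : ℝ) : ℂ) =
      (cgauss (v + T) y : ℂ) * (x * (cgauss w x : ℂ))
        + (cgauss (v + T) y : ℂ) * (k * y) * (cgauss w x : ℂ) := by
    intro x
    rw [add_sub_cancel_right]
    push_cast
    ring
  simp_rw [h]
  have hi1 : Integrable (fun x : ℂ => (cgauss (v + T) y : ℂ) * (x * (cgauss w x : ℂ))) :=
    (integrable_id_mul_cgauss hw).const_mul _
  have hi2 : Integrable (fun x : ℂ => (cgauss (v + T) y : ℂ) * (k * y) * (cgauss w x : ℂ)) :=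
    (integrable_cgauss hw).ofReal.const_mul _
  rw [integral_add hi1 hi2, integral_const_mul, integral_const_mul,
    integral_id_mul_cgauss, integral_complex_ofReal, integral_cgauss hw]
  push_cast [hk]
  ring

lemma integral_norm_sq_mul_cgauss_conv {v T : ℝ} (hv : 0 < v) (hT : 0 < T) (y : ℂ) :
    ∫ x : ℂ, ‖x‖ ^ 2 * (cgauss v x * cgauss T (y - x)) =
      cgauss (v + T) y * (v * T / (v + T) + (v / (v + T)) ^ 2 * ‖y‖ ^ 2) := by
  simp_rw [cgauss_mul_cgauss hv hT]
  set k : ℂ := ((v / (v + T) : ℝ) : ℂ) with hk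
  set w := v * T / (v + T)
  have hw : 0 < w := by positivity
  rw [← integral_add_right_eq_self _ (k * y)]
  have h : ∀ x : ℂ, ‖x + k * y‖ ^ 2 * (cgauss (v + T) y * cgauss w (x + k * y - k * y)) =
      cgauss (v + T) y * (cgauss w x * ‖x‖ ^ 2)
        + cgauss (v + T) y * ‖k * y‖ ^ 2 * cgauss w x
        + 2 * cgauss (v + T) y * (star (k * y) * (x * (cgauss w x : ℂ))).re := by
    intro x
    rw [add_sub_cancel_right]
    simp only [← Complex.normSq_eq_norm_sq, Complex.normSq_add, ← mul_assoc, Complex.re_mul_ofReal]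
    rw [mul_comm x]
    simp
    ring
  have hi : Integrable (fun x : ℂ => star (k * y) * (x * (cgauss w x : ℂ))) :=
    (integrable_id_mul_cgauss hw).const_mul _
  have h0 : ∫ x : ℂ, (star (k * y) * (x * (cgauss w x : ℂ))).re = 0 := by
    have := integral_re hi
    simp only [RCLike.re_eq_complex_re] at this
    rw [this, integral_const_mul, integral_id_mul_cgauss]
    simp
  have hk2 : ‖k * y‖ ^ 2 = (v / (v + T)) ^ 2 * ‖y‖ ^ 2 := by
    rw [norm_mul, mul_pow, hk, Complex.norm_real, Real.norm_eq_abs, sq_abs]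
  simp_rw [h]
  have hi1 : Integrable (fun x : ℂ => cgauss (v + T) y * (cgauss w x * ‖x‖ ^ 2)) :=
    (integrable_cgauss_mul_norm_sq hw).const_mul _
  have hi2 : Integrable (fun x : ℂ => cgauss (v + T) y * ‖k * y‖ ^ 2 * cgauss w x) :=
    (integrable_cgauss hw).const_mul _
  have hi3 : Integrable (fun x : ℂ =>
      2 * cgauss (v + T) y * (star (k * y) * (x * (cgauss w x : ℂ))).re) :=
    hi.re.const_mul _
  have hi12 : Integrable (fun x : ℂ => cgauss (v + T) y * (cgauss w x * ‖x‖ ^ 2) +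
      cgauss (v + T) y * ‖k * y‖ ^ 2 * cgauss w x) := hi1.add hi2
  rw [integral_add hi12 hi3, integral_add hi1 hi2]
  simp only [integral_const_mul]
  rw [h0, integral_cgauss hw, integral_cgauss_mul_norm_sq hw, hk2]
  ring

lemma integrableOn_phibar_integrand {C s : ℝ} (hC : 0 ≤ C) :
    IntegrableOn (fun t => t * Real.exp (-t) / (1 + C * Real.exp (-s * t))) (Ioi 0) := by
  refine Integrable.mono' integrableOn_exp_neg_mul_id
    (Measurable.aestronglyMeasurable (by fun_prop)) ?_
  filter_upwards [ae_restrict_mem measurableSet_Ioi] with t ht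
  have ht : 0 < t := ht
  have h1 : 0 ≤ C * Real.exp (-s * t) := by positivity
  rw [Real.norm_of_nonneg (by positivity), mul_comm (Real.exp _)]
  exact div_le_self (by positivity) (by linarith)

lemma phibar_one (lam s : ℝ) : phibar lam 1 s =
    ∫ t in Ioi (0 : ℝ),
      t * Real.exp (-t) / (1 + (1 - lam) / lam * (1 + s) * Real.exp (-s * t)) := by
  simp [phibar]

lemma abs_one_sub_phibar_one_le {lam s : ℝ} (hlam : lam ∈ Ioo (0 : ℝ) 1) (hs : 0 ≤ s) :
    |1 - phibar lam 1 s| ≤ (1 - lam) / lam / (1 + s) := by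
  obtain ⟨h0, h1⟩ := hlam
  have hC : 0 ≤ (1 - lam) / lam * (1 + s) := by
    have : 0 < 1 - lam := by linarith
    positivity
  have hlap : ∫ t in Ioi (0 : ℝ), t * Real.exp (-((1 + s) * t)) = 1 / (1 + s) ^ 2 := by
    have := Real.integral_rpow_mul_exp_neg_mul_Ioi (a := 2) (r := 1 + s) two_pos (by positivity)
    norm_num at this
    rw [this, one_div]
  have hlapi : IntegrableOn (fun t => t * Real.exp (-((1 + s) * t))) (Ioi 0) := by
    refine Integrable.mono' integrableOn_exp_neg_mul_id
      (Measurable.aestronglyMeasurable (by fun_prop)) ?_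
    filter_upwards [ae_restrict_mem measurableSet_Ioi] with t ht
    have ht : 0 < t := ht
    rw [Real.norm_of_nonneg (by positivity), mul_comm]
    gcongr
    nlinarith
  have hdiff := integral_sub integrableOn_exp_neg_mul_id (integrableOn_phibar_integrand (s := s) hC)
  rw [integral_exp_neg_mul_id, ← phibar_one] at hdiff
  rw [← hdiff, ← Real.norm_eq_abs]
  set C := (1 - lam) / lam * (1 + s) with hCdef
  calc _ ≤ ∫ t in Ioi (0 : ℝ), C * (t * Real.exp (-((1 + s) * t))) := by
        refine norm_integral_le_of_norm_le (hlapi.const_mul C) ?_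
        filter_upwards [ae_restrict_mem measurableSet_Ioi] with t ht
        have ht : 0 < t := ht
        have he : Real.exp (-((1 + s) * t)) = Real.exp (-t) * Real.exp (-s * t) := by
          rw [← Real.exp_add]; ring_nf
        have h2 : 0 ≤ C * Real.exp (-s * t) := by positivity
        have h3 : Real.exp (-t) * t - t * Real.exp (-t) / (1 + C * Real.exp (-s * t)) =
            Real.exp (-t) * t * (C * Real.exp (-s * t)) / (1 + C * Real.exp (-s * t)) := by
          field_simp
          ring
        rw [h3, Real.norm_of_nonneg (by positivity), he]
        refine (div_le_self (by positivity) (by linarith)).trans (le_of_eq (by ring))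
    _ = _ := by
        rw [integral_const_mul, hlap, hCdef]
        field_simp

lemma cgauss_eq_mul_cgauss_add {v T : ℝ} (hv : 0 < v) (hT : 0 < T) (x : ℂ) :
    cgauss T x = cgauss (v + T) x * ((1 + v / T) * Real.exp (-(v / T) * (‖x‖ ^ 2 / (v + T)))) := by
  have := Real.pi_pos.ne'
  unfold cgauss
  rw [mul_mul_mul_comm, ← Real.exp_add]
  congr 1
  · field_simp
    ring
  · congr 1
    field_simp
    ring

lemma integral_posterior_variance {v T lam : ℝ} (hv : 0 < v) (hT : 0 < T)
    (hlam : lam ∈ Ioo (0 : ℝ) 1) :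
    ∫ x : ℂ, (lam * (cgauss (v + T) x * (v * T / (v + T) + (v / (v + T)) ^ 2 * ‖x‖ ^ 2)) -
      ‖(lam : ℂ) * (((v / (v + T) * cgauss (v + T) x : ℝ) : ℂ) * x)‖ ^ 2 /
        ((1 - lam) * cgauss T x + lam * cgauss (v + T) x)) =
      lam * v * T / (v + T) + lam * v ^ 2 * (1 - phibar lam 1 (v / T)) / (v + T) := by
  obtain ⟨h0, h1⟩ := hlam
  have h1' : 0 < 1 - lam := by linarith
  have hS : 0 < v + T := by positivity
  have hC : 0 ≤ (1 - lam) / lam * (1 + v / T) := by positivity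
  set D : ℝ → ℝ := fun t => 1 + (1 - lam) / lam * (1 + v / T) * Real.exp (-(v / T) * t) with hD
  have hDpos : ∀ t, 0 < D t := fun t => by positivity
  have hpt : ∀ x : ℂ, lam * (cgauss (v + T) x * (v * T / (v + T) + (v / (v + T)) ^ 2 * ‖x‖ ^ 2)) -
      ‖(lam : ℂ) * (((v / (v + T) * cgauss (v + T) x : ℝ) : ℂ) * x)‖ ^ 2 /
        ((1 - lam) * cgauss T x + lam * cgauss (v + T) x) =
      cgauss (v + T) x * (lam * v * T / (v + T) + lam * v ^ 2 / (v + T) * (‖x‖ ^ 2 / (v + T))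
        - lam * v ^ 2 / (v + T) * (‖x‖ ^ 2 / (v + T) / D (‖x‖ ^ 2 / (v + T)))) := by
    intro x
    have hp : 0 < cgauss (v + T) x := by
      have := Real.pi_pos
      unfold cgauss; positivity
    have hden : (1 - lam) * cgauss T x + lam * cgauss (v + T) x =
        lam * cgauss (v + T) x * D (‖x‖ ^ 2 / (v + T)) := by
      rw [cgauss_eq_mul_cgauss_add hv hT, hD]
      field_simp
      ring
    rw [hden]
    have hd := hDpos (‖x‖ ^ 2 / (v + T))
    simp only [norm_mul, mul_pow, Complex.norm_real, Real.norm_eq_abs, sq_abs]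
    generalize D (‖x‖ ^ 2 / (v + T)) = d at *
    generalize cgauss (v + T) x = p at *
    field_simp
  refine (integral_congr_ae (Filter.Eventually.of_forall hpt)).trans
    ((integral_cgauss_mul_comp hS (fun t => lam * v * T / (v + T) +
      lam * v ^ 2 / (v + T) * t - lam * v ^ 2 / (v + T) * (t / D t))).trans ?_)
  have hsplit : ∀ t, Real.exp (-t) * (lam * v * T / (v + T) + lam * v ^ 2 / (v + T) * t
        - lam * v ^ 2 / (v + T) * (t / D t)) = lam * v * T / (v + T) * Real.exp (-t) +
      lam * v ^ 2 / (v + T) * (Real.exp (-t) * t) -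
      lam * v ^ 2 / (v + T) * (t * Real.exp (-t) / D t) := fun t => by ring
  simp_rw [hsplit]
  have i1 := integrableOn_exp_neg.const_mul (lam * v * T / (v + T))
  have i2 := integrableOn_exp_neg_mul_id.const_mul (lam * v ^ 2 / (v + T))
  have i3 := (integrableOn_phibar_integrand (s := v / T) hC).const_mul (lam * v ^ 2 / (v + T))
  have i12 : IntegrableOn (fun t => lam * v * T / (v + T) * Real.exp (-t) +
      lam * v ^ 2 / (v + T) * (Real.exp (-t) * t)) (Ioi 0) := i1.add i2
  rw [integral_sub i12 i3, integral_add i1 i2]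
  simp only [integral_const_mul]
  rw [integral_exp_neg_Ioi_zero, integral_exp_neg_mul_id, ← phibar_one]
  ring

lemma integrable_exp_neg_sq : Integrable fun s : ℝ => Real.exp (-s ^ 2) := by
  simpa using integrable_exp_neg_mul_sq one_pos

lemma Qfun_nonneg (b c g : ℝ) : 0 ≤ Qfun b c g :=
  integral_nonneg fun _ => (Real.exp_pos _).le

lemma measurable_Qfun (b c : ℝ) : Measurable (Qfun b c) := by
  have h : Antitone fun u : ℝ => ∫ s in Ioi u, Real.exp (-s ^ 2) := fun u w huw =>
    setIntegral_mono_set integrable_exp_neg_sq.integrableOn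
      (Filter.Eventually.of_forall fun _ => (Real.exp_pos _).le)
      (Ioi_subset_Ioi huw).eventuallyLE
  exact h.measurable.comp (g := fun u : ℝ => ∫ s in Ioi u, Real.exp (-s ^ 2))
    (f := fun g : ℝ => b * Real.log g + c) (by fun_prop)

lemma Qfun_le {K : ℝ} (hK : 0 ≤ K) (b c : ℝ) {g : ℝ} (hg : 0 < g) :
    Qfun b c g ≤ Real.exp (K ^ 2 / 2 - K * c) * (∫ s : ℝ, Real.exp (-(1 / 2) * s ^ 2)) *
      g ^ (-K * b) := by
  have hi : Integrable fun s : ℝ => Real.exp (-(1 / 2) * s ^ 2) :=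
    integrable_exp_neg_mul_sq (by norm_num)
  set M := Real.exp (K ^ 2 / 2 - K * (b * Real.log g + c)) with hM
  have h1 : Qfun b c g ≤ M * ∫ s : ℝ, Real.exp (-(1 / 2) * s ^ 2) := by
    calc Qfun b c g
        ≤ ∫ s in Ioi (b * Real.log g + c), M * Real.exp (-(1 / 2) * s ^ 2) := by
          refine setIntegral_mono_on integrable_exp_neg_sq.integrableOn
            (hi.const_mul M).integrableOn measurableSet_Ioi fun s hs => ?_
          have hs : b * Real.log g + c < s := hs
          rw [hM, ← Real.exp_add]
          gcongr
          nlinarith [sq_nonneg (s - K), mul_le_mul_of_nonneg_left hs.le hK]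
      _ ≤ ∫ s : ℝ, M * Real.exp (-(1 / 2) * s ^ 2) :=
          setIntegral_le_integral (hi.const_mul M)
            (Filter.Eventually.of_forall fun s => by positivity)
      _ = _ := integral_const_mul _ _
  refine h1.trans (le_of_eq ?_)
  rw [hM, Real.rpow_def_of_pos hg, mul_right_comm, ← Real.exp_add]
  ring_nf

lemma integrableOn_rpow_mul_Qfun {γ b : ℝ} (hγ : 1 < γ) (hb : b < 0) (c : ℝ) :
    IntegrableOn (fun g => g ^ (-γ) * Qfun b c g) (Ioi 0) := by
  have hmeas : Measurable fun g : ℝ => g ^ (-γ) * Qfun b c g :=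
    (measurable_id.pow_const _).mul (measurable_Qfun b c)
  rw [← Ioc_union_Ioi_eq_Ioi zero_le_one]
  refine IntegrableOn.union ?_ ?_
  · refine Integrable.mono' (g := fun _ => Real.exp ((γ / -b) ^ 2 / 2 - (γ / -b) * c) *
      ∫ s : ℝ, Real.exp (-(1 / 2) * s ^ 2)) (integrable_const _) hmeas.aestronglyMeasurable ?_
    filter_upwards [ae_restrict_mem measurableSet_Ioc] with g hg
    have hg0 : 0 < g := hg.1
    have hK : 0 ≤ γ / -b := div_nonneg (by linarith) (by linarith)
    have h := Qfun_le hK b c hg0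
    have hKb : -(γ / -b) * b = γ := by
      rw [neg_mul, div_mul_eq_mul_div, div_neg, neg_neg, mul_div_cancel_right₀ _ hb.ne]
    rw [hKb] at h
    rw [Real.norm_of_nonneg (mul_nonneg (by positivity) (Qfun_nonneg b c g))]
    calc _ ≤ g ^ (-γ) * _ := mul_le_mul_of_nonneg_left h (by positivity)
      _ = _ := by
        rw [mul_left_comm, ← Real.rpow_add hg0, neg_add_cancel, Real.rpow_zero, mul_one]
  · have h1 : IntegrableOn (fun g : ℝ => g ^ (-γ)) (Ioi 1) :=
      integrableOn_Ioi_rpow_of_lt (by linarith) one_pos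
    refine Integrable.mono' (h1.mul_const (∫ s : ℝ, Real.exp (-(1 / 2) * s ^ 2)))
      hmeas.aestronglyMeasurable ?_
    filter_upwards [ae_restrict_mem measurableSet_Ioi] with g hg
    have hg0 : 0 < g := one_pos.trans hg
    have h := Qfun_le le_rfl b c hg0
    norm_num at h
    rw [Real.norm_of_nonneg (mul_nonneg (by positivity) (Qfun_nonneg b c g))]
    gcongr
    norm_num
    exact h

lemma measurable_phibar_one (lam : ℝ) : Measurable (phibar lam 1) := by
  have h : StronglyMeasurable (fun p : ℝ × ℝ => p.2 ^ 1 * Real.exp (-p.2) /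
      (1 + (1 - lam) / lam * (1 + p.1) ^ 1 * Real.exp (-p.1 * p.2))) :=
    Measurable.stronglyMeasurable (by fun_prop)
  exact (h.integral_prod_right' (ν := volume.restrict (Ioi 0))).measurable

/-- the large-scale-fading-averaged Bayes risk of the MMSE denoiser with known
large-scale fading. -/
theorem stmt7
    (R α β σ : ℝ) (hR : 0 < R) (hβ : 0 < β) (hσ : 0 < σ)
    (γ a b c : ℝ)
    (hγ : γ = 40 / β + 1)
    (ha : a = 40 / (R ^ 2 * β * Real.sqrt Real.pi) *
      Real.exp (2 * (Real.log 10) ^ 2 * σ ^ 2 / β ^ 2 - 2 * (Real.log 10) * α / β))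
    (hb : b = -10 * Real.sqrt 2 / ((Real.log 10) * σ))
    (hc : c = (-α - β * Real.logb 10 R) / (Real.sqrt 2 * σ) - 20 / (β * b))
    (τ lam : ℝ) (hτ : 0 < τ) (hlam : lam ∈ Set.Ioo (0 : ℝ) 1)
    (m A : ℝ → ℂ → ℝ) (B : ℝ → ℂ → ℂ)
    (hm : ∀ g xt, m g xt = (1 - lam) * cgauss (τ ^ 2) xt +
      lam * ∫ x : ℂ, cgauss (g ^ 2) x * cgauss (τ ^ 2) (xt - x))
    (hB : ∀ g xt, B g xt = (lam : ℂ) *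
      ∫ x : ℂ, x * ((cgauss (g ^ 2) x * cgauss (τ ^ 2) (xt - x) : ℝ) : ℂ))
    (hA : ∀ g xt, A g xt = lam *
      ∫ x : ℂ, ‖x‖ ^ 2 * (cgauss (g ^ 2) x * cgauss (τ ^ 2) (xt - x))) :
    ∫ g in Set.Ioi (0 : ℝ),
        pG a γ b c g * ∫ xt : ℂ, (A g xt - ‖B g xt‖ ^ 2 / m g xt) =
      (∫ g in Set.Ioi (0 : ℝ),
        a * Qfun b c g * g ^ (-γ) * (lam * g ^ 2 * τ ^ 2 / (g ^ 2 + τ ^ 2))) +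
      ∫ g in Set.Ioi (0 : ℝ),
        a * lam * Qfun b c g * g ^ (4 - γ) * (1 - phibar lam 1 (g ^ 2 / τ ^ 2)) /
          (g ^ 2 + τ ^ 2) := by
  have hγ1 : 1 < γ := by
    rw [hγ]
    have : 0 < 40 / β := by positivity
    linarith
  have hb0 : b < 0 := by
    rw [hb]
    have : 0 < Real.log 10 := Real.log_pos (by norm_num)
    apply div_neg_of_neg_of_pos
    · have := Real.sqrt_pos.2 (two_pos (α := ℝ))
      linarith
    · positivity
  have hbase := integrableOn_rpow_mul_Qfun hγ1 hb0 c
  have hC : 0 ≤ (1 - lam) / lam := div_nonneg (by linarith [hlam.2]) hlam.1.le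
  have i1 : IntegrableOn (fun g : ℝ =>
      a * Qfun b c g * g ^ (-γ) * (lam * g ^ 2 * τ ^ 2 / (g ^ 2 + τ ^ 2))) (Ioi 0) := by
    refine Integrable.mono' (hbase.norm.const_mul (|a| * |lam| * τ ^ 2))
      (Measurable.aestronglyMeasurable ?_) (Filter.Eventually.of_forall fun g => ?_)
    · have := measurable_Qfun b c
      fun_prop
    · have h : |g ^ 2 / (g ^ 2 + τ ^ 2)| ≤ 1 := by
        rw [abs_of_nonneg (by positivity)]
        exact div_le_one_of_le₀ (by nlinarith) (by positivity)
      calc _ = |a| * |lam| * τ ^ 2 * ‖g ^ (-γ) * Qfun b c g‖ * |g ^ 2 / (g ^ 2 + τ ^ 2)| := by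
            simp only [Real.norm_eq_abs, abs_mul, abs_div, abs_pow, sq_abs]
            ring
        _ ≤ _ := mul_le_of_le_one_right (by positivity) h
  have i2 : IntegrableOn (fun g : ℝ =>
      a * lam * Qfun b c g * g ^ (4 - γ) * (1 - phibar lam 1 (g ^ 2 / τ ^ 2)) /
          (g ^ 2 + τ ^ 2)) (Ioi 0) := by
    refine Integrable.mono' (hbase.norm.const_mul (|a| * |lam| * ((1 - lam) / lam * τ ^ 2)))
      (Measurable.aestronglyMeasurable ?_) ?_
    · have := measurable_Qfun b c
      have := measurable_phibar_one lam
      fun_prop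
    · filter_upwards [ae_restrict_mem measurableSet_Ioi] with g hg
      have hg : 0 < g := hg
      have h := abs_one_sub_phibar_one_le hlam (s := g ^ 2 / τ ^ 2) (by positivity)
      have hle : |1 - phibar lam 1 (g ^ 2 / τ ^ 2)| * (g ^ 4 / (g ^ 2 + τ ^ 2)) ≤
          (1 - lam) / lam * τ ^ 2 := by
        calc _ ≤ (1 - lam) / lam / (1 + g ^ 2 / τ ^ 2) * (g ^ 4 / (g ^ 2 + τ ^ 2)) := by gcongr
          _ = (1 - lam) / lam * τ ^ 2 * (g ^ 4 / (g ^ 2 + τ ^ 2) ^ 2) := by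
            have := hlam.1
            field_simp
            ring
          _ ≤ _ := by
            refine mul_le_of_le_one_right (by positivity)
              (div_le_one_of_le₀ ?_ (by positivity))
            nlinarith [sq_nonneg (g * τ), sq_nonneg (τ ^ 2)]
      calc _ = |a| * |lam| * ‖g ^ (-γ) * Qfun b c g‖ *
              (|1 - phibar lam 1 (g ^ 2 / τ ^ 2)| * (g ^ 4 / (g ^ 2 + τ ^ 2))) := by
            rw [show (4 - γ : ℝ) = -γ + (4 : ℕ) by push_cast; ring,
              Real.rpow_add_natCast hg.ne']
            have hS : |g ^ 2 + τ ^ 2| = g ^ 2 + τ ^ 2 := abs_of_pos (by positivity)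
            simp only [Real.norm_eq_abs, abs_mul, abs_div, hS, abs_pow, abs_of_pos hg]
            ring
        _ ≤ |a| * |lam| * ‖g ^ (-γ) * Qfun b c g‖ * ((1 - lam) / lam * τ ^ 2) := by gcongr
        _ = _ := by ring
  rw [← integral_add i1 i2]
  refine setIntegral_congr_fun measurableSet_Ioi fun g hg => ?_
  have hg : 0 < g := hg
  have hv : 0 < g ^ 2 := by positivity
  have hT : 0 < τ ^ 2 := by positivity
  simp only [hA, hB, hm, integral_cgauss_conv hv hT, integral_id_mul_cgauss_conv hv hT,
    integral_norm_sq_mul_cgauss_conv hv hT]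
  rw [integral_posterior_variance hv hT hlam, pG, if_pos hg,
    show (4 - γ : ℝ) = -γ + (4 : ℕ) by push_cast; ring, Real.rpow_add_natCast hg.ne']
  ring
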